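/- arXiv:math-ph/0309062 — 3 statements merged into one kernel-verified Lean document; each statement's English description precedes it below -/
import Mathlib

section
/- Let ε, μ > 0 and β ∈ ℝ. Suppose smooth (C³) vector fields E, H, j : ℝ × ℝ³ → ℝ³ and a smooth function ρ : ℝ × ℝ³ → ℝ solve the chiral Maxwell system: rot H = ε(∂ₜE + β ∂ₜ rot E) + j; rot E = −μ(∂ₜH + β ∂ₜ rot H); div E = ρ/ε; div H = 0. Then H satisfies the chiral wave equation rot rot H + εμ ∂ₜ²H + 2βεμ ∂ₜ² rot H + β²εμ ∂ₜ² rot rot H = rot j. -/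
noncomputable section

/-- Points of `ℝ³`. -/
abbrev V3 : Type := Fin 3 → ℝ

/-- Biquaternions `ℍ[ℂ]`: quaternions with complex coefficients. -/
abbrev BQ : Type := Quaternion ℂ

/-- Euclidean norm on `ℝ³`. -/
def enorm3 (x : V3) : ℝ := Real.sqrt (x 0 ^ 2 + x 1 ^ 2 + x 2 ^ 2)

/-- Spatial partial derivative of a real-valued function. -/
def pdR (k : Fin 3) (g : V3 → ℝ) (x : V3) : ℝ := fderiv ℝ g x (Pi.single k 1)

/-- Spatial partial derivative of a complex-valued function. -/
def pdC (k : Fin 3) (g : V3 → ℂ) (x : V3) : ℂ := fderiv ℝ g x (Pi.single k 1)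

/-- Divergence (in the space variables) of a time-dependent vector field. -/
def div3 (E : ℝ × V3 → V3) (p : ℝ × V3) : ℝ :=
  ∑ k : Fin 3, pdR k (fun y => E (p.1, y) k) p.2

/-- Curl (in the space variables) of a time-dependent vector field. -/
def rot3 (E : ℝ × V3 → V3) (p : ℝ × V3) : V3 :=
  ![pdR 1 (fun y => E (p.1, y) 2) p.2 - pdR 2 (fun y => E (p.1, y) 1) p.2,
    pdR 2 (fun y => E (p.1, y) 0) p.2 - pdR 0 (fun y => E (p.1, y) 2) p.2,
    pdR 0 (fun y => E (p.1, y) 1) p.2 - pdR 1 (fun y => E (p.1, y) 0) p.2]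

/-- Time derivative of a vector field. -/
def ptV (E : ℝ × V3 → V3) (p : ℝ × V3) : V3 := deriv (fun s => E (s, p.2)) p.1

/-- Time derivative of a scalar (real-valued) function. -/
def ptR (ρ : ℝ × V3 → ℝ) (p : ℝ × V3) : ℝ := deriv (fun s => ρ (s, p.2)) p.1

/-- Build a biquaternion from a complex scalar part and a complex vector part. -/
def bq (s : ℂ) (v : Fin 3 → ℂ) : BQ := ⟨s, v 0, v 1, v 2⟩

/-- A complex vector as a purely vectorial biquaternion. -/
def vecC (v : Fin 3 → ℂ) : BQ := bq 0 v

/-- A real vector as a purely vectorial biquaternion. -/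
def vecR (v : V3) : BQ := vecC (fun k => (v k : ℂ))

/-- The basic quaternionic imaginary units `i₁, i₂, i₃`. -/
def qi : Fin 3 → BQ := ![⟨0,1,0,0⟩, ⟨0,0,1,0⟩, ⟨0,0,0,1⟩]

/-- Componentwise spatial partial derivative of a biquaternion-valued function. -/
def pdQ (k : Fin 3) (F : V3 → BQ) (x : V3) : BQ :=
  ⟨pdC k (fun y => (F y).re) x, pdC k (fun y => (F y).imI) x,
   pdC k (fun y => (F y).imJ) x, pdC k (fun y => (F y).imK) x⟩

/-- The Moisil–Teodoresco operator `D F = i₁ ∂₁F + i₂ ∂₂F + i₃ ∂₃F`. -/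
def Dop (F : V3 → BQ) (x : V3) : BQ :=
  qi 0 * pdQ 0 F x + qi 1 * pdQ 1 F x + qi 2 * pdQ 2 F x

/-- The Moisil–Teodoresco operator acting in the space variables. -/
def DQ (F : ℝ × V3 → BQ) (p : ℝ × V3) : BQ := Dop (fun y => F (p.1, y)) p.2

/-- Componentwise time derivative of a biquaternion-valued function. -/
def ptQ (F : ℝ × V3 → BQ) (p : ℝ × V3) : BQ :=
  ⟨deriv (fun s => (F (s, p.2)).re) p.1, deriv (fun s => (F (s, p.2)).imI) p.1,
   deriv (fun s => (F (s, p.2)).imJ) p.1, deriv (fun s => (F (s, p.2)).imK) p.1⟩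

/-- The operator `M = β√(εμ) ∂ₜ D + √(εμ) ∂ₜ − iD`. -/
def Mop (ε μ β : ℝ) (F : ℝ × V3 → BQ) (p : ℝ × V3) : BQ :=
  ((β * Real.sqrt (ε * μ) : ℝ) : ℂ) • ptQ (DQ F) p
    + ((Real.sqrt (ε * μ) : ℝ) : ℂ) • ptQ F p
    - Complex.I • DQ F p

/-- The complex conjugate operator `M* = β√(εμ) ∂ₜ D + √(εμ) ∂ₜ + iD`. -/
def MstarOp (ε μ β : ℝ) (F : ℝ × V3 → BQ) (p : ℝ × V3) : BQ :=
  ((β * Real.sqrt (ε * μ) : ℝ) : ℂ) • ptQ (DQ F) p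
    + ((Real.sqrt (ε * μ) : ℝ) : ℂ) • ptQ F p
    + Complex.I • DQ F p

/-- `C^n` smoothness of a biquaternion-valued function, componentwise. -/
def ContDiffQ (n : ℕ∞) (F : ℝ × V3 → BQ) : Prop :=
  ContDiff ℝ n (fun p => (F p).re) ∧ ContDiff ℝ n (fun p => (F p).imI) ∧
  ContDiff ℝ n (fun p => (F p).imJ) ∧ ContDiff ℝ n (fun p => (F p).imK)

/-- `Θ_α(x) = −e^{iα|x|}/(4π|x|)`. -/
def Theta (α : ℂ) (x : V3) : ℂ :=
  -Complex.exp (Complex.I * α * (enorm3 x : ℝ)) / (4 * Real.pi * (enorm3 x : ℝ))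

/-- `𝒦_α(x) = (α + x/|x|² − iα x/|x|) Θ_α(x)`. -/
def Kfun (α : ℂ) (x : V3) : BQ :=
  Theta α x • ((α : BQ) + (((enorm3 x ^ 2)⁻¹ : ℝ) : ℂ) • vecR x
    - (Complex.I * α * ((enorm3 x : ℝ) : ℂ)⁻¹) • vecR x)


/-- Auxiliary: the curl as a linear function of the Fréchet derivative. -/
def rotAux (L : ℝ × V3 →L[ℝ] V3) : V3 :=
  ![L (0, Pi.single 1 1) 2 - L (0, Pi.single 2 1) 1,
    L (0, Pi.single 2 1) 0 - L (0, Pi.single 0 1) 2,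
    L (0, Pi.single 0 1) 1 - L (0, Pi.single 1 1) 0]

theorem ptV_eq {F : ℝ × V3 → V3} (hF : Differentiable ℝ F) :
    ptV F = fun p => fderiv ℝ F p (1, 0) := by
  funext p
  have h1 : HasDerivAt (fun s : ℝ => (s, p.2)) ((1 : ℝ), (0 : V3)) p.1 :=
    (hasDerivAt_id p.1).prodMk (hasDerivAt_const p.1 p.2)
  exact ((hF (p.1, p.2)).hasFDerivAt.comp_hasDerivAt p.1 h1).deriv

theorem pdR_eq {F : ℝ × V3 → V3} (hF : Differentiable ℝ F) (k i : Fin 3) (p : ℝ × V3) :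
    pdR k (fun y => F (p.1, y) i) p.2 = fderiv ℝ F p (0, Pi.single k 1) i := by
  have h1 : HasFDerivAt (fun y : V3 => (p.1, y)) (ContinuousLinearMap.inr ℝ ℝ V3) p.2 :=
    hasFDerivAt_prodMk_right p.1 p.2
  have h2 := (hF (p.1, p.2)).hasFDerivAt.comp p.2 h1
  have h3 := (hasFDerivAt_pi'.1 h2 i).fderiv
  unfold pdR
  have h4 : (fun y => F (p.1, y) i) = fun x => (F ∘ fun y => (p.1, y)) x i := rfl
  rw [h4, h3]
  simp

theorem rot3_eq {F : ℝ × V3 → V3} (hF : Differentiable ℝ F) :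
    rot3 F = fun p => rotAux (fderiv ℝ F p) := by
  funext p
  simp only [rot3, rotAux, pdR_eq hF]

theorem ptV_cd {F : ℝ × V3 → V3} (m n : ℕ) (hF : ContDiff ℝ n F) (hmn : m + 1 ≤ n) :
    ContDiff ℝ m (ptV F) := by
  have hmn' : ((m : WithTop ℕ∞) + 1) ≤ n := by exact_mod_cast hmn
  rw [ptV_eq ((hF.of_le hmn').differentiable (by simp))]
  exact (hF.fderiv_right hmn').clm_apply contDiff_const

theorem rot3_cd {F : ℝ × V3 → V3} (m n : ℕ) (hF : ContDiff ℝ n F) (hmn : m + 1 ≤ n) :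
    ContDiff ℝ m (rot3 F) := by
  have hmn' : ((m : WithTop ℕ∞) + 1) ≤ n := by exact_mod_cast hmn
  rw [rot3_eq ((hF.of_le hmn').differentiable (by simp))]
  have h : ∀ v : ℝ × V3, ∀ i, ContDiff ℝ m (fun p => fderiv ℝ F p v i) := fun v i =>
    contDiff_pi.1 ((hF.fderiv_right hmn').clm_apply contDiff_const) i
  rw [contDiff_pi]
  intro i
  fin_cases i
  · exact (h _ _).sub (h _ _)
  · exact (h _ _).sub (h _ _)
  · exact (h _ _).sub (h _ _)

theorem fderiv_apply_aux {F : ℝ × V3 → V3} (hF : ContDiff ℝ 2 F) (v w : ℝ × V3) (p : ℝ × V3) :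
    fderiv ℝ (fun q => fderiv ℝ F q v) p w = fderiv ℝ (fderiv ℝ F) p w v := by
  have hd : Differentiable ℝ (fderiv ℝ F) :=
    (hF.fderiv_right (m := 1) (by norm_num)).differentiable (by simp)
  rw [fderiv_clm_apply (hd p) (differentiableAt_const v)]
  simp

theorem rot3_ptV {F : ℝ × V3 → V3} (hF : ContDiff ℝ 2 F) :
    rot3 (ptV F) = ptV (rot3 F) := by
  have hF1 : Differentiable ℝ F := hF.differentiable (by simp)
  have hd : Differentiable ℝ (fderiv ℝ F) :=
    (hF.fderiv_right (m := 1) (by norm_num)).differentiable (by simp)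
  have hs : ∀ p v w, fderiv ℝ (fderiv ℝ F) p v w = fderiv ℝ (fderiv ℝ F) p w v := fun p v w =>
    (hF.contDiffAt.isSymmSndFDerivAt (by simp)).eq v w
  rw [rot3_eq ((ptV_cd 1 2 hF (by norm_num)).differentiable (by simp)),
    ptV_eq ((rot3_cd 1 2 hF (by norm_num)).differentiable (by simp)), ptV_eq hF1, rot3_eq hF1]
  funext p
  have hc : ∀ v : ℝ × V3, ∀ i, HasFDerivAt (fun q => fderiv ℝ F q v i)
      ((ContinuousLinearMap.proj i).comp (fderiv ℝ (fun q => fderiv ℝ F q v) p)) p := fun v i =>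
    hasFDerivAt_pi'.1 ((hd p).clm_apply (differentiableAt_const v)).hasFDerivAt i
  have hR : DifferentiableAt ℝ (fun q => rotAux (fderiv ℝ F q)) p := by
    have := (rot3_cd 1 2 hF (by norm_num)).differentiable (by simp) p
    rwa [rot3_eq hF1] at this
  have hRi := fun i => hasFDerivAt_pi'.1 hR.hasFDerivAt i
  funext i
  have e : ∀ a b v w, HasFDerivAt (fun q => rotAux (fderiv ℝ F q) i)
      ((ContinuousLinearMap.proj (R := ℝ) (φ := fun _ : Fin 3 => ℝ) a).comp
          (fderiv ℝ (fun q => fderiv ℝ F q v) p)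
        - (ContinuousLinearMap.proj (R := ℝ) (φ := fun _ : Fin 3 => ℝ) b).comp
          (fderiv ℝ (fun q => fderiv ℝ F q w) p)) p →
      fderiv ℝ (fun q => rotAux (fderiv ℝ F q)) p (1, 0) i =
        fderiv ℝ (fun q => fderiv ℝ F q (1, 0)) p v a
        - fderiv ℝ (fun q => fderiv ℝ F q (1, 0)) p w b := by
    intro a b v w h
    have := congrArg (fun L : ℝ × V3 →L[ℝ] ℝ => L (1, 0)) ((hRi i).unique h)
    simp only [ContinuousLinearMap.comp_apply, ContinuousLinearMap.sub_apply,
      ContinuousLinearMap.proj_apply, fderiv_apply_aux hF] at this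
    rw [this, fderiv_apply_aux hF, fderiv_apply_aux hF, hs p v, hs p w]
  fin_cases i
  · exact (e 2 1 _ _ ((hc _ _).sub (hc _ _))).symm
  · exact (e 0 2 _ _ ((hc _ _).sub (hc _ _))).symm
  · exact (e 1 0 _ _ ((hc _ _).sub (hc _ _))).symm

theorem rot3_add {F G : ℝ × V3 → V3} (hF : Differentiable ℝ F) (hG : Differentiable ℝ G) :
    rot3 (F + G) = rot3 F + rot3 G := by
  rw [rot3_eq (hF.add hG), rot3_eq hF, rot3_eq hG]
  funext p i
  rw [fderiv_add (hF p) (hG p)]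
  fin_cases i <;> simp [rotAux] <;> ring

theorem rot3_smul {F : ℝ × V3 → V3} (hF : Differentiable ℝ F) (c : ℝ) :
    rot3 (c • F) = c • rot3 F := by
  rw [rot3_eq (hF.const_smul c), rot3_eq hF]
  funext p i
  rw [fderiv_const_smul (hF p)]
  fin_cases i <;> simp [rotAux] <;> ring

theorem ptV_add {F G : ℝ × V3 → V3} (hF : Differentiable ℝ F) (hG : Differentiable ℝ G) :
    ptV (F + G) = ptV F + ptV G := by
  rw [ptV_eq (hF.add hG), ptV_eq hF, ptV_eq hG]
  funext p
  rw [fderiv_add (hF p) (hG p)]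
  simp

theorem ptV_smul (F : ℝ × V3 → V3) (c : ℝ) : ptV (c • F) = c • ptV F := by
  funext p
  exact deriv_fun_const_smul_field c (fun s => F (s, p.2))

/-- A solution of the chiral Maxwell system satisfies the chiral wave
equation for `H`:
`rot rot H + εμ ∂ₜ²H + 2βεμ ∂ₜ² rot H + β²εμ ∂ₜ² rot rot H = rot j`. -/
theorem chiral_wave_equation_H
    (ε μ β : ℝ) (hε : 0 < ε) (hμ : 0 < μ)
    (E H j : ℝ × V3 → V3) (ρ : ℝ × V3 → ℝ)
    (hE : ContDiff ℝ 3 E) (hH : ContDiff ℝ 3 H)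
    (hj : ContDiff ℝ 3 j) (hρ : ContDiff ℝ 3 ρ)
    (hMax1 : ∀ p : ℝ × V3, rot3 H p = ε • (ptV E p + β • ptV (rot3 E) p) + j p)
    (hMax2 : ∀ p : ℝ × V3, rot3 E p = -(μ • (ptV H p + β • ptV (rot3 H) p)))
    (hMax3E : ∀ p : ℝ × V3, div3 E p = ρ p / ε)
    (hMax3H : ∀ p : ℝ × V3, div3 H p = 0) :
    ∀ p : ℝ × V3,
      rot3 (rot3 H) p + (ε * μ) • ptV (ptV H) p
        + (2 * β * ε * μ) • ptV (ptV (rot3 H)) p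
        + (β ^ 2 * ε * μ) • ptV (ptV (rot3 (rot3 H))) p
      = rot3 j p := by
  have hE' : ContDiff ℝ (3 : ℕ) E := by exact_mod_cast hE
  have hH' : ContDiff ℝ (3 : ℕ) H := by exact_mod_cast hH
  have hE2 : ContDiff ℝ 2 E := hE.of_le (by norm_num)
  have hH2 : ContDiff ℝ 2 H := hH.of_le (by norm_num)
  have hj1 : Differentiable ℝ j := hj.differentiable (by simp)
  have dd : ∀ {n : ℕ} {F : ℝ × V3 → V3}, ContDiff ℝ (n + 1 : ℕ) F → Differentiable ℝ F :=
    fun h => h.differentiable (by simp)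
  have rE := rot3_cd 2 3 hE' le_rfl
  have rH := rot3_cd 2 3 hH' le_rfl
  have tE := ptV_cd 2 3 hE' le_rfl
  have tH := ptV_cd 2 3 hH' le_rfl
  have trE := ptV_cd 1 2 rE le_rfl
  have trH := ptV_cd 1 2 rH le_rfl
  have rrE := rot3_cd 1 2 rE le_rfl
  have M1 : rot3 H = ε • (ptV E + β • ptV (rot3 E)) + j := funext hMax1
  have M2 : rot3 E = (-μ) • (ptV H + β • ptV (rot3 H)) := by
    funext p
    rw [hMax2 p, ← neg_smul]; rfl
  -- curl of the first equation
  have A : rot3 (rot3 H) = ε • (ptV (rot3 E) + β • ptV (rot3 (rot3 E))) + rot3 j := by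
    conv_lhs => rw [M1]
    rw [rot3_add (((dd tE).add ((dd trE).const_smul β)).const_smul ε) hj1,
      rot3_smul ((dd tE).add ((dd trE).const_smul β)),
      rot3_add (dd tE) ((dd trE).const_smul β), rot3_smul (dd trE), rot3_ptV hE2,
      rot3_ptV (by exact_mod_cast rE)]
  -- curl of the second equation
  have B : rot3 (rot3 E) = (-μ) • (ptV (rot3 H) + β • ptV (rot3 (rot3 H))) := by
    conv_lhs => rw [M2]
    rw [rot3_smul ((dd tH).add ((dd trH).const_smul β)),
      rot3_add (dd tH) ((dd trH).const_smul β), rot3_smul (dd trH), rot3_ptV hH2,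
      rot3_ptV (by exact_mod_cast rH)]
  have C : ptV (rot3 E) = (-μ) • (ptV (ptV H) + β • ptV (ptV (rot3 H))) := by
    conv_lhs => rw [M2]
    rw [ptV_smul, ptV_add (dd tH) ((dd trH).const_smul β), ptV_smul]
  have K : β • ptV (rot3 (rot3 H)) = (-μ⁻¹) • rot3 (rot3 E) + (-1 : ℝ) • ptV (rot3 H) := by
    rw [B]
    funext p i
    simp
    field_simp
    ring
  have hK : Differentiable ℝ (β • ptV (rot3 (rot3 H))) := by
    rw [K]
    exact ((dd rrE).const_smul _).add ((dd trH).const_smul _)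
  have D : ptV (rot3 (rot3 E)) =
      (-μ) • (ptV (ptV (rot3 H)) + β • ptV (ptV (rot3 (rot3 H)))) := by
    conv_lhs => rw [B]
    rw [ptV_smul, ptV_add (dd trH) hK, ptV_smul]
  intro p
  rw [C, D] at A
  have A' := congrFun A p
  funext i
  have A2 := congrFun A' i
  simp only [Pi.add_apply, Pi.smul_apply, smul_eq_mul] at A2 ⊢
  rw [A2]
  ring
end
end

section
/- Let α ∈ ℂ. The function 𝒦_α(x) = (α + x/|x|² − iα x/|x|) Θ_α(x), with Θ_α(x) = −e^{iα|x|}/(4π|x|), satisfies (D + α) 𝒦_α(x) = 0 for every x ∈ ℝ³ ∖ {0}. -/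
noncomputable section

set_option linter.unusedSimpArgs false

lemma enorm3_pos' {x : V3} (hx : x ≠ 0) : 0 < x 0 ^ 2 + x 1 ^ 2 + x 2 ^ 2 := by
  by_contra h
  apply hx
  have h0 : x 0 = 0 := by nlinarith [sq_nonneg (x 0), sq_nonneg (x 1), sq_nonneg (x 2)]
  have h1 : x 1 = 0 := by nlinarith [sq_nonneg (x 0), sq_nonneg (x 1), sq_nonneg (x 2)]
  have h2 : x 2 = 0 := by nlinarith [sq_nonneg (x 0), sq_nonneg (x 1), sq_nonneg (x 2)]
  funext i
  fin_cases i <;> simp [h0, h1, h2]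

lemma coord_hasFDerivAt (x : V3) (j : Fin 3) :
    HasFDerivAt (fun y : V3 => y j) (ContinuousLinearMap.proj (R := ℝ) (φ := fun _ : Fin 3 => ℝ) j) x :=
  (ContinuousLinearMap.proj (R := ℝ) (φ := fun _ : Fin 3 => ℝ) j).hasFDerivAt

lemma enorm3_hasFDerivAt {x : V3} (hx : x ≠ 0) :
    ∃ L : V3 →L[ℝ] ℝ, HasFDerivAt enorm3 L x ∧
      ∀ k, L (Pi.single k 1) = x k / enorm3 x := by
  have hp := enorm3_pos' hx
  have h := ((((coord_hasFDerivAt x 0).pow 2).add ((coord_hasFDerivAt x 1).pow 2)).add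
    ((coord_hasFDerivAt x 2).pow 2)).sqrt hp.ne'
  refine ⟨_, h, ?_⟩
  intro k
  have hr : √(x 0 ^ 2 + x 1 ^ 2 + x 2 ^ 2) ≠ 0 := (Real.sqrt_pos.2 hp).ne'
  fin_cases k <;> simp [enorm3] <;> field_simp

lemma pd1 {x : V3} (hx : x ≠ 0) (k : Fin 3) {f : ℝ → ℂ} {f' : ℂ}
    (hf : HasDerivAt f f' (enorm3 x)) :
    pdC k (fun y => f (enorm3 y)) x = (x k : ℂ) / (enorm3 x : ℂ) * f' := by
  obtain ⟨L, hL, hk⟩ := enorm3_hasFDerivAt hx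
  have h := hf.hasFDerivAt.comp x hL
  have h' : fderiv ℝ (fun y => f (enorm3 y)) x = _ := h.fderiv
  rw [pdC, h']
  simp [hk]

lemma pd2 {x : V3} (hx : x ≠ 0) (k j : Fin 3) {f : ℝ → ℂ} {f' : ℂ}
    (hf : HasDerivAt f f' (enorm3 x)) :
    pdC k (fun y => f (enorm3 y) * (y j : ℂ)) x
      = (x k : ℂ) / (enorm3 x : ℂ) * f' * x j + f (enorm3 x) * (if k = j then 1 else 0) := by
  obtain ⟨L, hL, hk⟩ := enorm3_hasFDerivAt hx
  have h := hf.hasFDerivAt.comp x hL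
  have hj : HasFDerivAt (fun y : V3 => (y j : ℂ)) _ x :=
    Complex.ofRealCLM.hasFDerivAt.comp x (coord_hasFDerivAt x j)
  have h' : fderiv ℝ (fun y => f (enorm3 y) * (y j : ℂ)) x = _ := (h.mul hj).fderiv
  rw [pdC, h']
  by_cases hkj : k = j
  · subst hkj
    simp [hk]
    ring
  · simp [hk, hkj, Pi.single_apply, eq_comm (a := j)]
    ring

def thF (α : ℂ) (t : ℝ) : ℂ :=
  -Complex.exp (Complex.I * α * (t : ℝ)) / (4 * Real.pi * (t : ℝ))

lemma thF_deriv (α : ℂ) {t : ℝ} (ht : t ≠ 0) :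
    HasDerivAt (thF α) (thF α t * (Complex.I * α - (t : ℂ)⁻¹)) t := by
  have htc : (t : ℂ) ≠ 0 := by exact_mod_cast ht
  have hpi : (Real.pi : ℂ) ≠ 0 := by exact_mod_cast Real.pi_ne_zero
  have ho : HasDerivAt (fun s : ℝ => (s : ℂ)) 1 t := Complex.ofRealCLM.hasDerivAt
  have h := ((ho.const_mul (Complex.I * α)).cexp.neg).div
    (ho.const_mul (4 * (Real.pi : ℂ))) (by simp [htc, hpi])
  refine h.congr_deriv ?_
  simp only [thF, Pi.neg_apply]
  field_simp
  ring

def gF (α : ℂ) (t : ℝ) : ℂ := thF α t * (((t : ℂ) ^ 2)⁻¹ - Complex.I * α * (t : ℂ)⁻¹)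

lemma gF_deriv (α : ℂ) {t : ℝ} (ht : t ≠ 0) :
    HasDerivAt (gF α) (thF α t * (Complex.I * α - (t : ℂ)⁻¹) *
        (((t : ℂ) ^ 2)⁻¹ - Complex.I * α * (t : ℂ)⁻¹)
      + thF α t * (-2 * ((t : ℂ) ^ 3)⁻¹ + Complex.I * α * ((t : ℂ) ^ 2)⁻¹)) t := by
  have htc : (t : ℂ) ≠ 0 := by exact_mod_cast ht
  have ho : HasDerivAt (fun s : ℝ => (s : ℂ)) 1 t := Complex.ofRealCLM.hasDerivAt
  have h := (thF_deriv α ht).mul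
    (((ho.pow 2).inv (pow_ne_zero 2 htc)).sub ((ho.inv htc).const_mul (Complex.I * α)))
  refine h.congr_deriv ?_
  simp only [Pi.sub_apply, Pi.inv_apply, Pi.pow_apply]
  push_cast
  field_simp
  ring

lemma vecR_re (v : V3) : (vecR v).re = 0 := rfl
lemma vecR_imI (v : V3) : (vecR v).imI = (v 0 : ℂ) := rfl
lemma vecR_imJ (v : V3) : (vecR v).imJ = (v 1 : ℂ) := rfl
lemma vecR_imK (v : V3) : (vecR v).imK = (v 2 : ℂ) := rfl
lemma qi0_re : (qi 0).re = 0 := rfl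
lemma qi0_imI : (qi 0).imI = 1 := rfl
lemma qi0_imJ : (qi 0).imJ = 0 := rfl
lemma qi0_imK : (qi 0).imK = 0 := rfl
lemma qi1_re : (qi 1).re = 0 := rfl
lemma qi1_imI : (qi 1).imI = 0 := rfl
lemma qi1_imJ : (qi 1).imJ = 1 := rfl
lemma qi1_imK : (qi 1).imK = 0 := rfl
lemma qi2_re : (qi 2).re = 0 := rfl
lemma qi2_imI : (qi 2).imI = 0 := rfl
lemma qi2_imJ : (qi 2).imJ = 0 := rfl
lemma qi2_imK : (qi 2).imK = 1 := rfl
lemma pdQ_re (k : Fin 3) (F : V3 → BQ) (x : V3) :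
    (pdQ k F x).re = pdC k (fun y => (F y).re) x := rfl
lemma pdQ_imI (k : Fin 3) (F : V3 → BQ) (x : V3) :
    (pdQ k F x).imI = pdC k (fun y => (F y).imI) x := rfl
lemma pdQ_imJ (k : Fin 3) (F : V3 → BQ) (x : V3) :
    (pdQ k F x).imJ = pdC k (fun y => (F y).imJ) x := rfl
lemma pdQ_imK (k : Fin 3) (F : V3 → BQ) (x : V3) :
    (pdQ k F x).imK = pdC k (fun y => (F y).imK) x := rfl
lemma Kfun_re (α : ℂ) (y : V3) : (Kfun α y).re = thF α (enorm3 y) * α := by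
  simp [Kfun, Theta, thF, vecR_re, vecR_imI, vecR_imJ, vecR_imK]
lemma Kfun_imI (α : ℂ) (y : V3) : (Kfun α y).imI = gF α (enorm3 y) * (y 0 : ℂ) := by
  simp [Kfun, Theta, thF, gF, vecR_re, vecR_imI, vecR_imJ, vecR_imK]; ring
lemma Kfun_imJ (α : ℂ) (y : V3) : (Kfun α y).imJ = gF α (enorm3 y) * (y 1 : ℂ) := by
  simp [Kfun, Theta, thF, gF, vecR_re, vecR_imI, vecR_imJ, vecR_imK]; ring
lemma Kfun_imK (α : ℂ) (y : V3) : (Kfun α y).imK = gF α (enorm3 y) * (y 2 : ℂ) := by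
  simp [Kfun, Theta, thF, gF, vecR_re, vecR_imI, vecR_imJ, vecR_imK]; ring

lemma Dop_re (F : V3 → BQ) (x : V3) : (Dop F x).re =
    - pdC 0 (fun y => (F y).imI) x - pdC 1 (fun y => (F y).imJ) x - pdC 2 (fun y => (F y).imK) x := by
  simp only [Dop, Quaternion.re_add, Quaternion.imI_add, Quaternion.imJ_add, Quaternion.imK_add,
    Quaternion.re_mul, Quaternion.imI_mul, Quaternion.imJ_mul, Quaternion.imK_mul,
    qi0_re, qi0_imI, qi0_imJ, qi0_imK, qi1_re, qi1_imI, qi1_imJ, qi1_imK, qi2_re, qi2_imI, qi2_imJ, qi2_imK, pdQ_re, pdQ_imI, pdQ_imJ, pdQ_imK]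
  ring

lemma Dop_imI (F : V3 → BQ) (x : V3) : (Dop F x).imI =
    pdC 0 (fun y => (F y).re) x + pdC 1 (fun y => (F y).imK) x - pdC 2 (fun y => (F y).imJ) x := by
  simp only [Dop, Quaternion.re_add, Quaternion.imI_add, Quaternion.imJ_add, Quaternion.imK_add,
    Quaternion.re_mul, Quaternion.imI_mul, Quaternion.imJ_mul, Quaternion.imK_mul,
    qi0_re, qi0_imI, qi0_imJ, qi0_imK, qi1_re, qi1_imI, qi1_imJ, qi1_imK, qi2_re, qi2_imI, qi2_imJ, qi2_imK, pdQ_re, pdQ_imI, pdQ_imJ, pdQ_imK]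
  ring

lemma Dop_imJ (F : V3 → BQ) (x : V3) : (Dop F x).imJ =
    pdC 1 (fun y => (F y).re) x - pdC 0 (fun y => (F y).imK) x + pdC 2 (fun y => (F y).imI) x := by
  simp only [Dop, Quaternion.re_add, Quaternion.imI_add, Quaternion.imJ_add, Quaternion.imK_add,
    Quaternion.re_mul, Quaternion.imI_mul, Quaternion.imJ_mul, Quaternion.imK_mul,
    qi0_re, qi0_imI, qi0_imJ, qi0_imK, qi1_re, qi1_imI, qi1_imJ, qi1_imK, qi2_re, qi2_imI, qi2_imJ, qi2_imK, pdQ_re, pdQ_imI, pdQ_imJ, pdQ_imK]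
  ring

lemma Dop_imK (F : V3 → BQ) (x : V3) : (Dop F x).imK =
    pdC 2 (fun y => (F y).re) x + pdC 0 (fun y => (F y).imJ) x - pdC 1 (fun y => (F y).imI) x := by
  simp only [Dop, Quaternion.re_add, Quaternion.imI_add, Quaternion.imJ_add, Quaternion.imK_add,
    Quaternion.re_mul, Quaternion.imI_mul, Quaternion.imJ_mul, Quaternion.imK_mul,
    qi0_re, qi0_imI, qi0_imJ, qi0_imK, qi1_re, qi1_imI, qi1_imJ, qi1_imK, qi2_re, qi2_imI, qi2_imJ, qi2_imK, pdQ_re, pdQ_imI, pdQ_imJ, pdQ_imK]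
  ring

/-- The function `𝒦_α` satisfies `(D + α) 𝒦_α = 0` away from the
origin. -/
theorem Kfun_in_kernel_of_D_alpha (α : ℂ) :
    ∀ x : V3, x ≠ 0 → Dop (Kfun α) x + α • Kfun α x = 0 := by
  intro x hx
  have hp := enorm3_pos' hx
  have hr : enorm3 x ≠ 0 := (Real.sqrt_pos.2 hp).ne'
  have hrc : (enorm3 x : ℂ) ≠ 0 := by exact_mod_cast hr
  have hsq : (enorm3 x : ℂ) ^ 2 = (x 0 : ℂ) ^ 2 + (x 1 : ℂ) ^ 2 + (x 2 : ℂ) ^ 2 := by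
    have : enorm3 x ^ 2 = x 0 ^ 2 + x 1 ^ 2 + x 2 ^ 2 := Real.sq_sqrt hp.le
    exact_mod_cast this
  have hI : Complex.I ^ 2 = -1 := Complex.I_sq
  have e0 : ∀ k, pdC k (fun y => (Kfun α y).re) x = _ := fun k => by
    simp only [Kfun_re]
    exact pd1 hx k ((thF_deriv α hr).mul_const α)
  have e1 : ∀ k, pdC k (fun y => (Kfun α y).imI) x = _ := fun k => by
    simp only [Kfun_imI]
    exact pd2 hx k 0 (gF_deriv α hr)
  have e2 : ∀ k, pdC k (fun y => (Kfun α y).imJ) x = _ := fun k => by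
    simp only [Kfun_imJ]
    exact pd2 hx k 1 (gF_deriv α hr)
  have e3 : ∀ k, pdC k (fun y => (Kfun α y).imK) x = _ := fun k => by
    simp only [Kfun_imK]
    exact pd2 hx k 2 (gF_deriv α hr)
  apply Quaternion.ext
  · rw [Quaternion.re_add, Quaternion.re_smul, Dop_re, e1, e2, e3, Kfun_re, Quaternion.re_zero]
    simp only [gF, if_true, smul_eq_mul]
    field_simp
    generalize (enorm3 x : ℂ) = r at *
    generalize thF α (enorm3 x) = T at *
    have hc : (x 2 : ℂ) ^ 2 = r ^ 2 - (x 0 : ℂ) ^ 2 - (x 1 : ℂ) ^ 2 := by rw [hsq]; ring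
    ring_nf
    simp only [hc, hI]
    ring
  · rw [Quaternion.imI_add, Quaternion.imI_smul, Dop_imI, e0, e2, e3, Kfun_imI, Quaternion.imI_zero]
    simp [gF]
    field_simp
    ring
  · rw [Quaternion.imJ_add, Quaternion.imJ_smul, Dop_imJ, e0, e1, e3, Kfun_imJ, Quaternion.imJ_zero]
    simp [gF]
    field_simp
    ring
  · rw [Quaternion.imK_add, Quaternion.imK_smul, Dop_imK, e0, e1, e2, Kfun_imK, Quaternion.imK_zero]
    simp [gF]
    field_simp
    ring
end
end

section
/- Let a ∈ ℂ with Im a > 0, let c ≥ 0 be real, and let t ∈ ℝ. Then (1/2π) ∫_{−∞}^{∞} e^{ic/(ω−a)} e^{iωt} / (ω − a)² dω (the integral converging absolutely) equals −t e^{iat} Σ_{j=0}^{∞} (−ct)^j / (j! (j+1)!) if t ≥ 0, and equals 0 if t < 0. -/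
open MeasureTheory

noncomputable section

lemma aux_int (m : ℕ) (z : ℂ) (hz : 0 < z.re) :
    IntegrableOn (fun s : ℝ => (s : ℂ) ^ m * Complex.exp (-z * s)) (Set.Ioi 0) := by
  have h := integrableOn_rpow_mul_exp_neg_mul_rpow (p := 1) (s := m) (b := z.re)
    (by have : (0:ℝ) ≤ m := m.cast_nonneg
        linarith) one_pos hz
  refine Integrable.mono' h ?_ ?_
  · exact (by fun_prop : Continuous (fun s : ℝ => (s : ℂ) ^ m * Complex.exp (-z * s))).aestronglyMeasurable
  · refine (ae_restrict_iff' measurableSet_Ioi).2 (Filter.Eventually.of_forall fun s hs => ?_)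
    have hs' : 0 < s := hs
    rw [norm_mul, Complex.norm_exp, norm_pow, Complex.norm_real, Real.norm_of_nonneg hs'.le]
    simp

lemma aux_val (m : ℕ) (z : ℂ) (hz : 0 < z.re) :
    ∫ s in Set.Ioi (0:ℝ), (s : ℂ) ^ m * Complex.exp (-z * s) = m.factorial / z ^ (m + 1) := by
  have hz0 : z ≠ 0 := by rintro rfl; simp at hz
  induction m with
  | zero =>
    have := integral_exp_mul_complex_Ioi (a := -z) (by simpa using hz) 0
    simp only [pow_zero, one_mul]
    rw [this]; simp
  | succ m ih =>
    have key := integral_Ioi_of_hasDerivAt_of_tendsto' (a := (0:ℝ)) (m := 0)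
      (f := fun s : ℝ => (s : ℂ) ^ (m+1) * Complex.exp (-z * s))
      (f' := fun s : ℝ => ((m:ℂ)+1) * ((s : ℂ) ^ m * Complex.exp (-z * s))
          - z * ((s : ℂ) ^ (m+1) * Complex.exp (-z * s))) ?_ ?_ ?_
    · rw [integral_sub ((aux_int m z hz).const_mul _) ((aux_int (m+1) z hz).const_mul _),
        integral_const_mul, integral_const_mul, ih] at key
      simp only [Complex.ofReal_zero, zero_pow (Nat.succ_ne_zero m), zero_mul, sub_zero] at key
      have h2 : z * ∫ s in Set.Ioi (0:ℝ), (s : ℂ) ^ (m+1) * Complex.exp (-z * s)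
          = ((m:ℂ)+1) * (m.factorial / z ^ (m + 1)) := by
        linear_combination -key
      apply mul_left_cancel₀ hz0
      rw [h2, Nat.factorial_succ]
      push_cast
      field_simp
      ring
    · intro x _
      have h1 : HasDerivAt (fun s : ℂ => s ^ (m+1) * Complex.exp (-z * s))
          (((m:ℂ)+1) * ((x : ℂ) ^ m * Complex.exp (-z * x))
          - z * ((x : ℂ) ^ (m+1) * Complex.exp (-z * x))) (x:ℂ) := by
        have := (hasDerivAt_pow (m+1) (x:ℂ)).mul (((hasDerivAt_id (x:ℂ)).const_mul (-z)).cexp)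
        refine this.congr_deriv ?_
        simp
        ring
      exact h1.comp_ofReal
    · exact ((aux_int m z hz).const_mul _).sub ((aux_int (m+1) z hz).const_mul _)
    · rw [tendsto_zero_iff_norm_tendsto_zero]
      have := tendsto_rpow_mul_exp_neg_mul_atTop_nhds_zero (m+1:ℕ) z.re hz
      refine this.congr' ?_
      filter_upwards [Filter.eventually_gt_atTop 0] with s hs'
      rw [norm_mul, Complex.norm_exp, norm_pow, Complex.norm_real, Real.norm_of_nonneg hs'.le, Real.rpow_natCast]
      simp

lemma aux_ne (a : ℂ) (ha : 0 < a.im) (w : ℝ) : (w:ℂ) - a ≠ 0 := by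
  intro h
  have := congrArg Complex.im h
  simp at this
  linarith

lemma aux_norm (a : ℂ) (ha : 0 < a.im) (w : ℝ) : a.im ≤ ‖(w:ℂ) - a‖ := by
  have := Complex.abs_im_le_norm ((w:ℂ) - a)
  simpa [abs_of_pos ha] using this

lemma aux_cont (a : ℂ) (ha : 0 < a.im) (n : ℕ) : Continuous fun w : ℝ => (((w:ℂ) - a) ^ n)⁻¹ := by
  refine Continuous.inv₀ (by fun_prop) (fun w => pow_ne_zero _ (aux_ne a ha w))

lemma aux_sq (a : ℂ) (ha : 0 < a.im) : Integrable fun w : ℝ => (((w:ℂ) - a) ^ 2)⁻¹ := by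
  have h0 := (integrable_inv_one_add_sq.comp_mul_left' (inv_ne_zero ha.ne')).comp_sub_right a.re
  refine Integrable.mono' (h0.const_mul (a.im^2)⁻¹) (aux_cont a ha 2).aestronglyMeasurable ?_
  refine Filter.Eventually.of_forall fun w => le_of_eq ?_
  rw [norm_inv, norm_pow, ← Complex.normSq_eq_norm_sq, Complex.normSq_apply]
  rw [← mul_inv]
  congr 1
  simp
  field_simp
  ring

lemma aux_pow (a : ℂ) (ha : 0 < a.im) (k : ℕ) (w : ℝ) :
    ‖(((w:ℂ) - a) ^ (k+2))⁻¹‖ ≤ (a.im⁻¹) ^ k * ‖(((w:ℂ) - a) ^ 2)⁻¹‖ := by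
  rw [pow_add, mul_inv, norm_mul]
  gcongr
  rw [norm_inv, norm_pow, ← inv_pow]
  gcongr
  exact aux_norm a ha w

lemma aux_powint (a : ℂ) (ha : 0 < a.im) (k : ℕ) : Integrable fun w : ℝ => (((w:ℂ) - a) ^ (k+2))⁻¹ :=
  Integrable.mono' ((aux_sq a ha).norm.const_mul (a.im⁻¹ ^ k)) (aux_cont a ha _).aestronglyMeasurable
    (Filter.Eventually.of_forall fun w => aux_pow a ha k w)

open FourierTransform in
lemma aux_inv (a : ℂ) (ha : 0 < a.im) (k : ℕ) (t : ℝ) :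
    ∫ w : ℝ, Complex.exp (Complex.I * w * t) * (((w:ℂ) - a) ^ (k+2))⁻¹ =
      2 * Real.pi * (Complex.I ^ (k+2) / (k+1).factorial *
        (((max t 0 : ℝ) : ℂ) ^ (k+1) * Complex.exp (Complex.I * a * t))) := by
  have hpi := Real.pi_pos
  set f : ℝ → ℂ := fun t => ((max t 0 : ℝ) : ℂ) ^ (k+1) * Complex.exp (Complex.I * a * t) with hf
  have hfc : Continuous f := by
    have : Continuous fun t : ℝ => max t 0 := by fun_prop
    fun_prop
  have hsupp : ∀ s, s ∉ Set.Ioi (0:ℝ) → f s = 0 := by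
    intro s hs
    have : s ≤ 0 := by simpa using hs
    simp [hf, max_eq_right this]
  have hfi : Integrable f := by
    rw [← integrableOn_iff_integrable_of_support_subset (s := Set.Ioi 0)]
    · refine (aux_int (k+1) (-(Complex.I * a)) (by simpa using ha)).congr_fun ?_ measurableSet_Ioi
      intro s hs
      have hs' : 0 < s := hs
      simp [hf, max_eq_left hs'.le]
    · intro s hs
      by_contra h
      exact hs (hsupp s h)
  have hF : ∀ w : ℝ, 𝓕 f w = (k+1).factorial / Complex.I ^ (k+2) *
      ((((2 * Real.pi * w : ℝ):ℂ) - a) ^ (k+2))⁻¹ := by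
    intro w
    rw [Real.fourier_real_eq_integral_exp_smul,
      ← setIntegral_eq_integral_of_forall_compl_eq_zero (s := Set.Ioi 0)]
    · have := aux_val (k+1) (Complex.I * (((2 * Real.pi * w : ℝ):ℂ) - a)) (by simpa using ha)
      rw [mul_pow] at this
      rw [← div_eq_mul_inv, div_div, ← this]
      refine setIntegral_congr_fun measurableSet_Ioi fun s hs => ?_
      have hs' : 0 < s := hs
      simp only [hf, max_eq_left hs'.le, smul_eq_mul]
      rw [mul_left_comm, ← Complex.exp_add]
      congr 2
      push_cast
      ring
    · intro s hs
      rw [hsupp s hs, smul_zero]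
  have hF' : 𝓕 f = fun w : ℝ => (k+1).factorial / Complex.I ^ (k+2) *
      ((((2 * Real.pi * w : ℝ):ℂ) - a) ^ (k+2))⁻¹ := funext hF
  have hFi : Integrable (𝓕 f) := by
    rw [hF']
    exact ((aux_powint a ha k).comp_mul_left' (R := 2 * Real.pi) (by positivity)).const_mul _
  have hinv := congrFun (hfc.fourierInv_fourier_eq hfi hFi) t
  rw [Real.fourierInv_eq', hF'] at hinv
  have hsub := Measure.integral_comp_mul_left (fun w : ℝ =>
    Complex.exp (Complex.I * w * t) * (((w:ℂ) - a) ^ (k+2))⁻¹) (2 * Real.pi)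
  have h3 : (fun v : ℝ => Complex.exp (((2 * Real.pi * inner ℝ v t : ℝ):ℂ) * Complex.I) •
      (((k+1).factorial : ℂ) / Complex.I ^ (k+2) *
      ((((2 * Real.pi * v : ℝ):ℂ) - a) ^ (k+2))⁻¹)) = fun v : ℝ =>
      (((k+1).factorial : ℂ) / Complex.I ^ (k+2)) *
       (Complex.exp (Complex.I * ((2 * Real.pi * v : ℝ):ℂ) * t) * ((((2 * Real.pi * v : ℝ):ℂ) - a) ^ (k+2))⁻¹) := by
    funext v
    rw [smul_eq_mul, mul_left_comm]
    congr 3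
    simp
    ring
  rw [h3, integral_const_mul, hsub, abs_of_pos (by positivity)] at hinv
  change _ = 2 * Real.pi * (Complex.I ^ (k+2) / (k+1).factorial * f t)
  rw [← hinv, Complex.real_smul]
  generalize (∫ w : ℝ, Complex.exp (Complex.I * w * t) * (((w:ℂ) - a) ^ (k+2))⁻¹) = J
  have : ((k+1).factorial : ℂ) ≠ 0 := by exact_mod_cast Nat.factorial_ne_zero _
  have hI : Complex.I ^ (k+2) ≠ 0 := pow_ne_zero _ Complex.I_ne_zero
  have hpi' : (Real.pi : ℂ) ≠ 0 := by exact_mod_cast hpi.ne'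
  push_cast
  field_simp

lemma aux_main (a : ℂ) (ha : 0 < a.im) (c t : ℝ) :
    (1 / (2 * (Real.pi : ℂ))) *
          ∫ ω : ℝ, Complex.exp (Complex.I * (c : ℂ) / ((ω : ℂ) - a))
            * Complex.exp (Complex.I * (ω : ℂ) * (t : ℂ)) / ((ω : ℂ) - a) ^ 2 =
        ∑' j : ℕ, (Complex.I * c) ^ j / j.factorial * (Complex.I ^ (j+2) / (j+1).factorial *
        (((max t 0 : ℝ) : ℂ) ^ (j+1) * Complex.exp (Complex.I * a * t))) := by
  have hpi' : (Real.pi : ℂ) ≠ 0 := by exact_mod_cast Real.pi_pos.ne'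
  set F : ℕ → ℝ → ℂ := fun j w => (Complex.I * c) ^ j / j.factorial *
    (Complex.exp (Complex.I * w * t) * (((w:ℂ) - a) ^ (j+2))⁻¹) with hF
  have hne : ∀ w : ℝ, ‖Complex.exp (Complex.I * w * t)‖ = 1 := by
    intro w
    rw [Complex.norm_exp]; simp
  have hFi : ∀ j, Integrable (F j) := by
    intro j
    refine Integrable.const_mul ?_ _
    refine (aux_powint a ha j).mono ?_ ?_
    · exact (Continuous.mul (by fun_prop) (aux_cont a ha _)).aestronglyMeasurable
    · refine Filter.Eventually.of_forall fun w => ?_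
      rw [norm_mul, hne, one_mul]
  have hsum : Summable fun j => ∫ w, ‖F j w‖ := by
    have hs : Summable fun j : ℕ => (|c| * a.im⁻¹) ^ j / j.factorial * ∫ w : ℝ, ‖(((w:ℂ) - a) ^ 2)⁻¹‖ :=
      (Real.summable_pow_div_factorial _).mul_right _
    refine Summable.of_nonneg_of_le (fun j => integral_nonneg fun _ => norm_nonneg _) (fun j => ?_) hs
    rw [← integral_const_mul]
    refine integral_mono (hFi j).norm ((aux_sq a ha).norm.const_mul _) fun w => ?_
    simp only [hF]
    rw [norm_mul, norm_mul, hne, one_mul]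
    have h1 : ‖(Complex.I * c) ^ j / (j.factorial : ℂ)‖ = |c| ^ j / j.factorial := by simp
    rw [h1, mul_pow, mul_div_right_comm, mul_assoc]
    gcongr
    exact aux_pow a ha j w
  have key := hasSum_integral_of_summable_integral_norm hFi hsum
  have hts : (fun w : ℝ => ∑' j, F j w) = fun ω : ℝ => Complex.exp (Complex.I * (c : ℂ) / ((ω : ℂ) - a))
            * Complex.exp (Complex.I * (ω : ℂ) * (t : ℂ)) / ((ω : ℂ) - a) ^ 2 := by
    funext w
    have h := (NormedSpace.expSeries_div_hasSum_exp (Complex.I * (c : ℂ) / ((w : ℂ) - a))).mul_right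
      (Complex.exp (Complex.I * (w : ℂ) * (t : ℂ)) / ((w : ℂ) - a) ^ 2)
    rw [← Complex.exp_eq_exp_ℂ] at h
    rw [mul_div_assoc, ← h.tsum_eq]
    congr 1
    funext j
    have := aux_ne a ha w
    simp only [hF]
    rw [div_pow]
    field_simp
    ring
  rw [hts] at key
  rw [← key.tsum_eq, ← tsum_mul_left]
  congr 1
  funext j
  simp only [hF]
  rw [integral_const_mul, aux_inv a ha]
  field_simp

/-- For `Im a > 0`, `c ≥ 0` and `t ∈ ℝ`, the absolutely convergent
integral `(1/2π) ∫ e^{ic/(ω−a)} e^{iωt}/(ω−a)² dω` equals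
`−t e^{iat} Σ_{j≥0} (−ct)^j/(j!(j+1)!)` for `t ≥ 0` and `0` for `t < 0`. -/
theorem integral_second_order_with_essential_factor
    (a : ℂ) (ha : 0 < a.im) (c : ℝ) (hc : 0 ≤ c) (t : ℝ) :
    Integrable (fun ω : ℝ =>
        Complex.exp (Complex.I * (c : ℂ) / ((ω : ℂ) - a))
          * Complex.exp (Complex.I * (ω : ℂ) * (t : ℂ)) / ((ω : ℂ) - a) ^ 2) ∧
    (0 ≤ t →
      (1 / (2 * (Real.pi : ℂ))) *
          ∫ ω : ℝ, Complex.exp (Complex.I * (c : ℂ) / ((ω : ℂ) - a))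
            * Complex.exp (Complex.I * (ω : ℂ) * (t : ℂ)) / ((ω : ℂ) - a) ^ 2 =
        -(t : ℂ) * Complex.exp (Complex.I * a * (t : ℂ)) *
          ∑' j : ℕ, ((-(c * t) : ℝ) : ℂ) ^ j /
            ((Nat.factorial j : ℂ) * (Nat.factorial (j + 1) : ℂ))) ∧
    (t < 0 →
      (1 / (2 * (Real.pi : ℂ))) *
          ∫ ω : ℝ, Complex.exp (Complex.I * (c : ℂ) / ((ω : ℂ) - a))
            * Complex.exp (Complex.I * (ω : ℂ) * (t : ℂ)) / ((ω : ℂ) - a) ^ 2 = 0) := by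
  refine ⟨?_, fun ht => ?_, fun ht => ?_⟩
  · have hcont : Continuous fun ω : ℝ => Complex.exp (Complex.I * (c : ℂ) / ((ω : ℂ) - a))
          * Complex.exp (Complex.I * (ω : ℂ) * (t : ℂ)) / ((ω : ℂ) - a) ^ 2 := by
      have h1 : Continuous fun ω : ℝ => Complex.I * (c : ℂ) / ((ω : ℂ) - a) :=
        Continuous.div (by fun_prop) (by fun_prop) (aux_ne a ha)
      exact Continuous.div (h1.cexp.mul (by fun_prop)) (by fun_prop)
        fun w => pow_ne_zero _ (aux_ne a ha w)
    refine Integrable.mono' ((aux_sq a ha).norm.const_mul (Real.exp (|c| * a.im⁻¹)))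
      hcont.aestronglyMeasurable (Filter.Eventually.of_forall fun w => ?_)
    have hne : ‖Complex.exp (Complex.I * w * t)‖ = 1 := by
      rw [Complex.norm_exp]; simp
    rw [div_eq_mul_inv, norm_mul, norm_mul, hne, mul_one]
    gcongr
    refine (Complex.norm_exp_le_exp_norm _).trans (Real.exp_le_exp.2 ?_)
    rw [norm_div, norm_mul, Complex.norm_I, one_mul, Complex.norm_real, Real.norm_eq_abs,
      div_eq_mul_inv]
    gcongr
    exact aux_norm a ha w
  · rw [aux_main a ha, max_eq_left ht, ← tsum_mul_left]
    congr 1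
    funext j
    have h : ((-(c * t) : ℝ) : ℂ) ^ j = (Complex.I * c) ^ j * Complex.I ^ j * (t:ℂ) ^ j := by
      rw [← mul_pow, ← mul_pow]
      congr 1
      push_cast
      linear_combination (-(c:ℂ) * t) * Complex.I_sq
    rw [h, pow_add Complex.I, Complex.I_sq, pow_succ (t:ℂ)]
    field_simp
  · rw [aux_main a ha, max_eq_right ht.le]
    simp
end
end
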